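/- arXiv:2510.16608 — 2 statements merged into one kernel-verified Lean document; each statement's English description precedes it below -/
import Mathlib

section
/- For every integer N ≥ 1 and every integer K with 0 ≤ K ≤ N, the function t ↦ G_N(K, t) is strictly decreasing on [0, ∞). -/
open Real Filter

/-- Likelihood ratio ℓ_N(K,t). -/
noncomputable def ell (q0 ρH ρL lam : ℝ) (N K : ℕ) (t : ℝ) : ℝ :=
  (q0 / (1 - q0)) * (ρH / ρL) ^ K *
    ((1 - ρH * (1 - Real.exp (-lam * t))) / (1 - ρL * (1 - Real.exp (-lam * t)))) ^ (N - K)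

/-- Belief of good type conditional on state, P_ρ(t). -/
noncomputable def Pst (ρ lam t : ℝ) : ℝ :=
  ρ * Real.exp (-lam * t) / (ρ * Real.exp (-lam * t) + 1 - ρ)

/-- Posterior probability of state H, Q_N(K,t). -/
noncomputable def Q (q0 ρH ρL lam : ℝ) (N K : ℕ) (t : ℝ) : ℝ :=
  ell q0 ρH ρL lam N K t / (1 + ell q0 ρH ρL lam N K t)

/-- Belief of good type G_N(K,t). -/
noncomputable def G (q0 ρH ρL lam : ℝ) (N K : ℕ) (t : ℝ) : ℝ :=
  Q q0 ρH ρL lam N K t * Pst ρH lam t + (1 - Q q0 ρH ρL lam N K t) * Pst ρL lam t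

lemma Pst_strictAnti {ρ lam : ℝ} (hlam : 0 < lam) (h0 : 0 < ρ) (h1 : ρ < 1) :
    StrictAnti (Pst ρ lam) := by
  intro s t hst
  have hx : exp (-lam * t) < exp (-lam * s) := exp_lt_exp.mpr (by nlinarith)
  have hs := mul_pos h0 (exp_pos (-lam * s))
  have ht := mul_pos h0 (exp_pos (-lam * t))
  unfold Pst
  rw [div_lt_div_iff₀ (by linarith) (by linarith)]
  nlinarith [mul_pos (mul_pos h0 (sub_pos.mpr h1)) (sub_pos.mpr hx)]

lemma Pst_lt_Pst {ρH ρL lam : ℝ} (hρL : 0 < ρL) (hρ : ρL < ρH) (hρH : ρH < 1) (t : ℝ) :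
    Pst ρL lam t < Pst ρH lam t := by
  have hx := exp_pos (-lam * t)
  have hL := mul_pos hρL hx
  have hH := mul_pos (hρL.trans hρ) hx
  unfold Pst
  rw [div_lt_div_iff₀ (by linarith) (by linarith)]
  nlinarith [mul_pos (sub_pos.mpr hρ) hx]

lemma one_sub_mul_one_sub_exp_pos {ρ : ℝ} (h0 : 0 < ρ) (h1 : ρ < 1) (x : ℝ) :
    0 < 1 - ρ * (1 - exp x) := by
  nlinarith [mul_pos h0 (exp_pos x)]

lemma ell_pos {q0 ρH ρL lam : ℝ} (hq0 : 0 < q0) (hq1 : q0 < 1)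
    (hρL : 0 < ρL) (hρ : ρL < ρH) (hρH : ρH < 1) (N K : ℕ) (t : ℝ) :
    0 < ell q0 ρH ρL lam N K t := by
  have hH := one_sub_mul_one_sub_exp_pos (hρL.trans hρ) hρH (-lam * t)
  have hL := one_sub_mul_one_sub_exp_pos hρL (hρ.trans hρH) (-lam * t)
  have hρH0 := hρL.trans hρ
  have hq := sub_pos.mpr hq1
  unfold ell
  positivity

lemma ell_antitone {q0 ρH ρL lam : ℝ} (hlam : 0 < lam) (hq0 : 0 < q0) (hq1 : q0 < 1)
    (hρL : 0 < ρL) (hρ : ρL < ρH) (hρH : ρH < 1) (N K : ℕ) :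
    Antitone (ell q0 ρH ρL lam N K) := by
  intro s t hst
  have hx : exp (-lam * t) ≤ exp (-lam * s) := exp_le_exp.mpr (by nlinarith)
  have hρH0 := hρL.trans hρ
  have hq := sub_pos.mpr hq1
  have hHt := one_sub_mul_one_sub_exp_pos hρH0 hρH (-lam * t)
  have hLt := one_sub_mul_one_sub_exp_pos hρL (hρ.trans hρH) (-lam * t)
  have hLs := one_sub_mul_one_sub_exp_pos hρL (hρ.trans hρH) (-lam * s)
  unfold ell
  refine mul_le_mul_of_nonneg_left (pow_le_pow_left₀ (by positivity) ?_ _) (by positivity)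
  rw [div_le_div_iff₀ hLt hLs]
  nlinarith [mul_nonneg (sub_nonneg.mpr hρ.le) (sub_nonneg.mpr hx)]

lemma Q_mem_Ioo {q0 ρH ρL lam : ℝ} (hq0 : 0 < q0) (hq1 : q0 < 1)
    (hρL : 0 < ρL) (hρ : ρL < ρH) (hρH : ρH < 1) (N K : ℕ) (t : ℝ) :
    Q q0 ρH ρL lam N K t ∈ Set.Ioo 0 1 := by
  have h := ell_pos (lam := lam) hq0 hq1 hρL hρ hρH N K t
  unfold Q
  exact ⟨by positivity, by rw [div_lt_one (by positivity)]; linarith⟩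

lemma Q_antitone {q0 ρH ρL lam : ℝ} (hlam : 0 < lam) (hq0 : 0 < q0) (hq1 : q0 < 1)
    (hρL : 0 < ρL) (hρ : ρL < ρH) (hρH : ρH < 1) (N K : ℕ) :
    Antitone (Q q0 ρH ρL lam N K) := by
  intro s t hst
  have hs := ell_pos (lam := lam) hq0 hq1 hρL hρ hρH N K s
  have ht := ell_pos (lam := lam) hq0 hq1 hρL hρ hρH N K t
  have h := ell_antitone hlam hq0 hq1 hρL hρ hρH N K hst
  unfold Q
  rw [div_le_div_iff₀ (by positivity) (by positivity)]
  linarith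

/-- for 0 ≤ K ≤ N, the belief G_N(K, ·) is strictly decreasing
on [0, ∞). -/
theorem belief_strictAnti_in_time
    (lam q0 ρH ρL : ℝ) (hlam : 0 < lam) (hq0 : 0 < q0) (hq1 : q0 < 1)
    (hρL : 0 < ρL) (hρ : ρL < ρH) (hρH : ρH < 1)
    (N : ℕ) (hN : 1 ≤ N) (K : ℕ) (hKN : K ≤ N) :
    StrictAntiOn (fun t => G q0 ρH ρL lam N K t) (Set.Ici (0 : ℝ)) := by
  intro s _ t _ hst
  have hH := Pst_strictAnti hlam (hρL.trans hρ) hρH hst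
  have hL := Pst_strictAnti hlam hρL (hρ.trans hρH) hst
  have hHL := Pst_lt_Pst (lam := lam) hρL hρ hρH t
  have hQ := Q_antitone hlam hq0 hq1 hρL hρ hρH N K hst.le
  obtain ⟨hQ0, hQ1⟩ := Q_mem_Ioo (lam := lam) hq0 hq1 hρL hρ hρH N K s
  simp only [G]
  linarith [mul_pos hQ0 (sub_pos.mpr hH), mul_pos (sub_pos.mpr hQ1) (sub_pos.mpr hL),
    mul_nonneg (sub_nonneg.mpr hQ) (sub_pos.mpr hHL).le]
end

section
/- (Key aggregation inequality.) For every k ∈ (0, k̂) and every t > 0 with φ_k(t) = 1, we have ρ_H·(1 − e^{−λt}) > k > ρ_L·(1 − e^{−λt}). -/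
open Real Filter

/-- The function φ_k(t). -/
noncomputable def phi (ρH ρL lam k t : ℝ) : ℝ :=
  (ρH / ρL) ^ k *
    ((1 - ρH * (1 - Real.exp (-lam * t))) / (1 - ρL * (1 - Real.exp (-lam * t)))) ^ (1 - k)

/-- The threshold k̂. -/
noncomputable def khat (ρH ρL : ℝ) : ℝ :=
  Real.log ((1 - ρL) / (1 - ρH)) /
    (Real.log (ρH / ρL) + Real.log ((1 - ρL) / (1 - ρH)))

/-- If the log-likelihoods `k log x + (1 - k) log (1 - x)` agree at two points `b < a` of `(0, 1)`,
then `k` lies strictly between these points. -/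
theorem between_of_weighted_log_eq_zero {a b k : ℝ} (hb : 0 < b) (hab : b < a) (ha : a < 1)
    (hk0 : 0 < k) (hk1 : k < 1)
    (h : k * log (a / b) + (1 - k) * log ((1 - a) / (1 - b)) = 0) : b < k ∧ k < a := by
  have ha0 : 0 < a := hb.trans hab
  have ha1 : 0 < 1 - a := by linarith
  have hb1 : 0 < 1 - b := by linarith
  have hk1' : 0 < 1 - k := by linarith
  have hd : 0 < a - b := by linarith
  constructor
  · have h1 : log (a / b) < a / b - 1 :=
      log_lt_sub_one_of_pos (by positivity) (by rw [Ne, div_eq_one_iff_eq hb.ne']; exact hab.ne')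
    have h2 : log ((1 - a) / (1 - b)) ≤ (1 - a) / (1 - b) - 1 :=
      log_le_sub_one_of_pos (by positivity)
    have h3 : 0 < k * (a / b - 1) + (1 - k) * ((1 - a) / (1 - b) - 1) := by
      nlinarith [mul_lt_mul_of_pos_left h1 hk0, mul_le_mul_of_nonneg_left h2 hk1'.le]
    have h4 : k * (a / b - 1) + (1 - k) * ((1 - a) / (1 - b) - 1)
        = (a - b) / (b * (1 - b)) * (k - b) := by
      field_simp
      ring
    rw [h4] at h3
    linarith [(mul_pos_iff_of_pos_left (by positivity)).mp h3]
  · have h1 : 1 - (a / b)⁻¹ < log (a / b) := by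
      have := log_lt_sub_one_of_pos (x := (a / b)⁻¹) (by positivity)
        (by rw [Ne, inv_eq_one, div_eq_one_iff_eq hb.ne']; exact hab.ne')
      rw [log_inv] at this
      linarith
    have h2 : 1 - ((1 - a) / (1 - b))⁻¹ ≤ log ((1 - a) / (1 - b)) :=
      one_sub_inv_le_log_of_pos (by positivity)
    have h3 : k * (1 - (a / b)⁻¹) + (1 - k) * (1 - ((1 - a) / (1 - b))⁻¹) < 0 := by
      nlinarith [mul_lt_mul_of_pos_left h1 hk0, mul_le_mul_of_nonneg_left h2 hk1'.le]
    have h4 : k * (1 - (a / b)⁻¹) + (1 - k) * (1 - ((1 - a) / (1 - b))⁻¹)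
        = -((a - b) / (a * (1 - a)) * (a - k)) := by
      field_simp
      ring
    rw [h4, neg_lt_zero] at h3
    linarith [(mul_pos_iff_of_pos_left (by positivity)).mp h3]

theorem khat_lt_one {ρH ρL : ℝ} (hρL : 0 < ρL) (hρ : ρL < ρH) (hρH : ρH < 1) :
    khat ρH ρL < 1 := by
  have h1 : 0 < log (ρH / ρL) := log_pos ((one_lt_div hρL).mpr hρ)
  have h2 : 0 < log ((1 - ρL) / (1 - ρH)) :=
    log_pos ((one_lt_div (by linarith)).mpr (by linarith))
  rw [khat, div_lt_one (by positivity)]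
  linarith

/-- key aggregation inequality: for k ∈ (0, k̂) and t > 0 with
φ_k(t) = 1, we have ρ_H(1 − e^{−λt}) > k > ρ_L(1 − e^{−λt}). -/
theorem aggregation_inequality
    (lam ρH ρL : ℝ) (hlam : 0 < lam)
    (hρL : 0 < ρL) (hρ : ρL < ρH) (hρH : ρH < 1)
    (k : ℝ) (hk0 : 0 < k) (hk : k < khat ρH ρL)
    (t : ℝ) (ht : 0 < t) (hphi : phi ρH ρL lam k t = 1) :
    ρL * (1 - Real.exp (-lam * t)) < k ∧ k < ρH * (1 - Real.exp (-lam * t)) := by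
  have hk1 : k < 1 := hk.trans (khat_lt_one hρL hρ hρH)
  rw [phi] at hphi
  have he : Real.exp (-lam * t) < 1 := by
    rw [Real.exp_lt_one_iff]
    nlinarith
  have he0 := Real.exp_pos (-lam * t)
  set s := 1 - Real.exp (-lam * t)
  have hs0 : 0 < s := by simp only [s]; linarith
  have hs1 : s < 1 := by simp only [s]; linarith
  have hρH0 : 0 < ρH := hρL.trans hρ
  have ha : ρH * s < 1 := by nlinarith
  have hab : ρL * s < ρH * s := by nlinarith
  have hq : 0 < (1 - ρH * s) / (1 - ρL * s) := div_pos (by linarith) (by linarith)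
  refine between_of_weighted_log_eq_zero (by positivity) hab ha hk0 hk1 ?_
  rw [mul_div_mul_right _ _ hs0.ne', ← log_rpow (by positivity), ← log_rpow hq,
    ← log_mul (by positivity) (by positivity), hphi, log_one]
end
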